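/- Let ω ∉ {ε, ab, ba, aba} be a factor of F_∞ with |ω| = f_k. Then: (1) ω ∈ T1.2 if and only if ω = C_i(F_k) for some i with f_{k-1}−1 ≤ i ≤ f_k−1; (2) ω ∈ T1.3 if and only if ω = C_i(F_k) for some i with 0 ≤ i ≤ f_{k-1}−2. -/

import Mathlib

/-- Finite Fibonacci words: `Fw k = σ^k(a)` where `a = false`, `b = true`,
`σ(a) = ab`, `σ(b) = a`; so `Fw (k+2) = Fw (k+1) ++ Fw k`. -/
def Fw : ℕ → List Bool
  | 0 => [false]
  | 1 => [false, true]
  | (k+2) => Fw (k+1) ++ Fw k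

/-- The infinite Fibonacci word `F_∞` (0-indexed): since `Fw (n+1)` has length
`fib (n+3) > n`, its `n`-th letter is the `n`-th letter of `F_∞`. -/
def fw (n : ℕ) : Bool := (Fw (n+1)).getD n false

/-- Singular words, with index shifted by one: `sw n = s_{n-1}`.
`sw 0 = s_{-1} = a`, and `sw (n+1) = s_n = β_n · F_n · α_n⁻¹` where
`α_n` is the last letter of `F_n` and `β_n` the other letter. -/
def sw : ℕ → List Bool
  | 0 => [false]
  | (n+1) => (!((Fw n).getLastD false)) :: (Fw n).dropLast

/-- The factor of `F_∞` of length `n` starting at (0-indexed) position `i`. -/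
def seg (i n : ℕ) : List Bool := (List.range n).map (fun t => fw (i + t))

/-- `w` occurs in `F_∞` at (0-indexed) position `i`. -/
def OccursAt (w : List Bool) (i : ℕ) : Prop := seg i w.length = w

/-- `w` is a factor of `F_∞`. -/
def IsFactor (w : List Bool) : Prop := ∃ i, OccursAt w i

/-- Starting position of the `(p+1)`-st occurrence of `w` in `F_∞`
(occurrences enumerated by starting position, 0-indexed: `occPos w 0`
is the first occurrence, i.e. the paper's `ω_1`). -/
noncomputable def occPos (w : List Bool) (p : ℕ) : ℕ := Nat.nth (OccursAt w) p

/-- A finite word viewed as an element of the free group on the alphabet. -/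
def listToFree (w : List Bool) : FreeGroup Bool := (w.map FreeGroup.of).prod

/-- The gap `ν_{w,p}` (0-indexed in `p`: `gap w 0` is the paper's `ν_{w,1}`)
between the `(p+1)`-st and `(p+2)`-nd occurrences of `w`, as an element of the
free group: the separating word if the occurrences are separated or adjacent,
and the formal inverse of the overlap if they overlap. -/
noncomputable def gap (w : List Bool) (p : ℕ) : FreeGroup Bool :=
  if occPos w p + w.length ≤ occPos w (p+1) then
    listToFree (seg (occPos w p + w.length) (occPos w (p+1) - (occPos w p + w.length)))
  else
    (listToFree (seg (occPos w (p+1)) (occPos w p + w.length - occPos w (p+1))))⁻¹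

/-- The signed length `|ν_{w,p}|` of the gap (negative in the overlapped case). -/
noncomputable def gapLen (w : List Bool) (p : ℕ) : ℤ :=
  (occPos w (p+1) : ℤ) - ((occPos w p : ℤ) + (w.length : ℤ))

/-- `u` is a singular word (some `s_k`, `k ≥ -1`). -/
def IsSingular (u : List Bool) : Prop := ∃ n, u = sw n

/-- `u` is a singular kernel of `w`: a singular factor of `w` of maximal length. -/
def IsKernelOf (u w : List Bool) : Prop :=
  IsSingular u ∧ u <:+: w ∧ ∀ v : List Bool, IsSingular v → v <:+: w → v.length ≤ u.length

/-- The excluded words `{ε, ab, ba, aba}`. -/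
def excl : List (List Bool) := [[], [false, true], [true, false], [false, true, false]]

/-- The `i`-th conjugate `C_i(w)` (indices taken mod the length). -/
def conj (i : ℕ) (w : List Bool) : List Bool :=
  w.drop (i % w.length) ++ w.take (i % w.length)

/-- `sliceW u i j = u[i,j]`, the letters `i` through `j` of `u`, 1-indexed. -/
def sliceW (u : List Bool) (i j : ℕ) : List Bool := (u.take j).drop (i - 1)

theorem length_Fw (k : ℕ) : (Fw k).length = Nat.fib (k + 2) := by
  induction k using Nat.twoStepInduction with
  | zero => rfl
  | one => rfl
  | more k h₀ h₁ => rw [Fw, List.length_append, h₀, h₁, Nat.fib_add_two (n := k + 2), add_comm]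

theorem Fw_ne_nil (k : ℕ) : Fw k ≠ [] := by
  rw [← List.length_pos_iff, length_Fw]
  exact Nat.fib_pos.2 (by omega)

theorem Fw_prefix_succ (k : ℕ) : Fw k <+: Fw (k + 1) := by
  cases k with
  | zero => exact ⟨[true], rfl⟩
  | succ k => exact ⟨Fw k, rfl⟩

theorem Fw_prefix {m n : ℕ} (h : m ≤ n) : Fw m <+: Fw n := by
  induction n, h using Nat.le_induction with
  | base => exact List.prefix_refl _
  | succ n _ ih => exact ih.trans (Fw_prefix_succ n)

/-- The last letter of `Fw k`. -/
def lastLetter (k : ℕ) : Bool := (Fw k).getLastD false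

theorem dropLast_Fw_append (k : ℕ) : (Fw k).dropLast ++ [lastLetter k] = Fw k := by
  rw [lastLetter, List.getLastD_eq_getLast?, List.getLast?_eq_getLast_of_ne_nil (Fw_ne_nil k)]
  exact List.dropLast_append_getLast (Fw_ne_nil k)

theorem lastLetter_succ (k : ℕ) : lastLetter (k + 1) = !lastLetter k := by
  induction k with
  | zero => rfl
  | succ k ih =>
    have h : lastLetter (k + 2) = lastLetter k := by
      simp [lastLetter, Fw, List.getLastD_eq_getLast?, List.getLast?_append,
        List.getLast?_eq_getLast_of_ne_nil (Fw_ne_nil k)]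
    rw [h, ih, Bool.not_not]

theorem sw_succ (k : ℕ) : sw (k + 1) = lastLetter (k + 1) :: (Fw k).dropLast := by
  rw [lastLetter_succ]; rfl

theorem length_sw (k : ℕ) : (sw k).length = Nat.fib (k + 1) := by
  cases k with
  | zero => rfl
  | succ k =>
    have := List.length_pos_iff.2 (Fw_ne_nil k)
    rw [sw_succ, List.length_cons, List.length_dropLast, ← length_Fw]
    omega

/-- `Fw (k+1) ++ Fw k` and `Fw k ++ Fw (k+1)` differ exactly in the order of the last two
letters. -/
theorem exists_near_commute (k : ℕ) : ∃ P : List Bool,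
    Fw (k + 1) ++ Fw k = P ++ [!lastLetter k, lastLetter k] ∧
      Fw k ++ Fw (k + 1) = P ++ [lastLetter k, !lastLetter k] := by
  induction k with
  | zero => exact ⟨[false], rfl, rfl⟩
  | succ k ih =>
    obtain ⟨P, h₁, h₂⟩ := ih
    refine ⟨Fw (k + 1) ++ P, ?_, ?_⟩
    · rw [lastLetter_succ, Bool.not_not, Fw, List.append_assoc, h₂, List.append_assoc]
    · rw [lastLetter_succ, Bool.not_not, Fw, h₁, List.append_assoc]

theorem conj_eq_rotate (i : ℕ) (w : List Bool) : conj i w = w.rotate i :=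
  List.rotate_eq_drop_append_take_mod.symm

theorem sw_succ_ne_conj (k i : ℕ) : sw (k + 1) ≠ conj i (Fw k) := by
  intro h
  have h₁ : (sw (k + 1)).count true = (Fw k).count true := by
    rw [h, conj_eq_rotate]
    exact (List.rotate_perm _ _).count_eq true
  rw [sw_succ, ← dropLast_Fw_append k, List.dropLast_concat, List.count_cons,
    List.count_append, lastLetter_succ] at h₁
  cases hl : lastLetter k <;> simp [hl] at h₁

theorem getElem?_append_self_append_self {v : List Bool} {n : ℕ} (hn : n < 3 * v.length) :
    (v ++ (v ++ v))[n]? = v[n % v.length]? := by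
  by_cases h₁ : n < v.length
  · rw [List.getElem?_append_left h₁, Nat.mod_eq_of_lt h₁]
  · rw [List.getElem?_append_right (by omega)]
    by_cases h₂ : n - v.length < v.length
    · rw [List.getElem?_append_left h₂, Nat.mod_eq_sub_mod (by omega), Nat.mod_eq_of_lt h₂]
    · rw [List.getElem?_append_right (by omega), Nat.mod_eq_sub_mod (by omega),
        Nat.mod_eq_sub_mod (by omega), Nat.mod_eq_of_lt (by omega)]

theorem exists_conj_of_infix_cube {w v : List Bool} (hv : v ≠ []) (hlen : w.length = v.length)
    (h : w <:+: v ++ (v ++ v)) : ∃ i < v.length, w = conj i v := by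
  obtain ⟨s, t, h⟩ := h
  have hpos := List.length_pos_iff.2 hv
  have hl := congrArg List.length h
  simp only [List.length_append] at hl
  refine ⟨s.length % v.length, Nat.mod_lt _ hpos, ?_⟩
  rw [conj_eq_rotate, List.rotate_mod]
  apply List.ext_getElem?
  intro n
  by_cases hn : n < v.length
  · rw [List.getElem?_rotate hn, add_comm n, ← getElem?_append_self_append_self (by omega), ← h,
      List.append_assoc, List.getElem?_append_right (by omega), Nat.add_sub_cancel_left,
      List.getElem?_append_left (by omega)]
  · rw [List.getElem?_eq_none (by omega), List.getElem?_eq_none (by simp; omega)]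

theorem exists_conj_of_infix_square {w v : List Bool} (hv : v ≠ []) (hlen : w.length = v.length)
    (h : w <:+: v ++ v) : ∃ i < v.length, w = conj i v :=
  exists_conj_of_infix_cube hv hlen (h.trans (List.suffix_append _ _).isInfix)

/-- Factors of length `|Fw (j+1)|` of `Fw j ++ Fw (j+1)`. -/
theorem classify_infix_append {j : ℕ} {w : List Bool} (hlen : w.length = (Fw (j + 1)).length)
    (h : w <:+: Fw j ++ Fw (j + 1)) :
    w = sw (j + 2) ∨ w <:+: Fw (j + 1) ++ Fw (j + 1) := by
  obtain ⟨P, h₁, h₂⟩ := exists_near_commute j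
  have hP : P <:+: Fw (j + 1) ++ Fw (j + 1) :=
    (List.IsPrefix.trans ⟨_, h₁.symm⟩
      ((List.prefix_append_right_inj _).2 (Fw_prefix_succ j))).isInfix
  have hsplit : P ++ [lastLetter j] = Fw j ++ (Fw (j + 1)).dropLast := by
    have h₃ := congrArg List.dropLast h₂
    rw [List.dropLast_append_of_ne_nil (Fw_ne_nil _)] at h₃
    rw [h₃, ← List.singleton_append, ← List.append_assoc P]
    simp
  have hsuffix : sw (j + 2) <:+ P ++ [lastLetter j] := by
    rw [hsplit, sw_succ, lastLetter_succ, lastLetter_succ, Bool.not_not]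
    refine ⟨(Fw j).dropLast, ?_⟩
    conv_rhs => rw [← dropLast_Fw_append j]
    simp
  rw [h₂, show P ++ [lastLetter j, !lastLetter j] =
      (P ++ [lastLetter j]) ++ [!lastLetter j] by simp, List.infix_concat_iff, List.infix_concat_iff] at h
  rcases h with h | h | h
  · right
    have hw : w <:+ Fw (j + 1) := by
      refine List.suffix_of_suffix_length_le h ?_ hlen.le
      refine ⟨Fw j, by rw [h₂]; simp⟩
    exact hw.isInfix.trans (List.infix_append' [] _ _)
  · left
    refine (List.suffix_of_suffix_length_le h hsuffix ?_).eq_of_length ?_ <;>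
      rw [hlen, length_sw, length_Fw]
  · exact Or.inr (h.trans hP)

theorem classify_infix_sandwich {j : ℕ} {w : List Bool} (hlen : w.length = (Fw (j + 1)).length)
    (h : w <:+: Fw (j + 1) ++ (Fw j ++ Fw (j + 1))) :
    w = sw (j + 2) ∨ ∃ i < (Fw (j + 1)).length, w = conj i (Fw (j + 1)) := by
  have key : w = sw (j + 2) ∨ w <:+: Fw (j + 1) ++ Fw (j + 1) := by
    rw [List.infix_append_iff] at h
    rcases h with h | h | ⟨x, y, rfl, hx, hy⟩
    · exact Or.inr (h.trans (List.infix_append' [] _ _))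
    · exact classify_infix_append hlen h
    · obtain ⟨P, h₁, h₂⟩ := exists_near_commute j
      have hl := congrArg List.length h₂
      have hj := List.length_pos_iff.2 (Fw_ne_nil j)
      simp only [List.length_append, List.length_cons, List.length_nil] at hl hlen
      by_cases hyP : y.length ≤ P.length
      · right
        have hy' : y <+: P := List.prefix_of_prefix_length_le hy ⟨_, h₂.symm⟩ hyP
        have hy'' : y <+: Fw (j + 1) := by
          refine List.prefix_of_prefix_length_le (hy'.trans ⟨_, h₁.symm⟩)
            (List.prefix_append _ _) (by omega)
        exact List.infix_append_iff.2 (Or.inr (Or.inr ⟨x, y, rfl, hx, hy''⟩))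
      · have : x = [] := List.eq_nil_of_length_eq_zero (by omega)
        subst this
        exact classify_infix_append (by simpa using hlen) hy.isInfix
  exact key.imp_right (exists_conj_of_infix_square (Fw_ne_nil _) hlen)

theorem Fw_suffix_or (k m : ℕ) : Fw k <:+ Fw (k + m) ∨ Fw (k + 1) <:+ Fw (k + m) := by
  induction m using Nat.twoStepInduction with
  | zero => exact Or.inl (List.suffix_refl _)
  | one => exact Or.inr (List.suffix_refl _)
  | more m h₀ _ =>
    have : Fw (k + m) <:+ Fw (k + (m + 2)) := List.suffix_append _ _
    exact h₀.imp (·.trans this) (·.trans this)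

/-- A factor of length `|Fw (j+1)|` of some `Fw m` is a conjugate of `Fw (j+1)` or the singular
word of that length. -/
theorem classify_infix_Fw {j : ℕ} {w : List Bool} (hlen : w.length = (Fw (j + 1)).length)
    (m : ℕ) (h : w <:+: Fw m) :
    w = sw (j + 2) ∨ ∃ i < (Fw (j + 1)).length, w = conj i (Fw (j + 1)) := by
  induction m using Nat.strong_induction_on with
  | _ m ih =>
  by_cases hm : m ≤ j + 1
  · exact Or.inr (exists_conj_of_infix_square (Fw_ne_nil _) hlen
      ((h.trans (Fw_prefix hm).isInfix).trans (List.infix_append' [] _ _)))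
  obtain ⟨n, rfl⟩ : ∃ n, m = j + n + 2 := ⟨m - j - 2, by omega⟩
  rw [Fw, List.infix_append_iff] at h
  rcases h with h' | h' | ⟨x, y, rfl, hx, hy⟩
  · exact ih _ (by omega) h'
  · exact ih _ (by omega) h'
  · simp only [List.length_append] at hlen
    have hy' : y <+: Fw (j + 1) :=
      List.prefix_of_prefix_length_le (hy.trans (Fw_prefix (by omega : j + n ≤ j + 1 + n)))
        (Fw_prefix (by omega)) (by omega)
    have hsuf := Fw_suffix_or (j + 1) n
    rw [show j + 1 + n = j + n + 1 by omega] at hsuf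
    have hlen' : (x ++ y).length = (Fw (j + 1)).length := by rwa [List.length_append]
    rcases hsuf with hs | hs
    · have hx' := List.suffix_of_suffix_length_le hx hs (by omega)
      exact Or.inr (exists_conj_of_infix_square (Fw_ne_nil _) hlen'
        (List.infix_append_iff.2 (Or.inr (Or.inr ⟨x, y, rfl, hx', hy'⟩))))
    · have hx' := List.suffix_of_suffix_length_le hx hs
        (by have := (Fw_prefix_succ (j + 1)).length_le; omega)
      apply classify_infix_sandwich hlen'
      rw [← List.append_assoc]
      exact List.infix_append_iff.2 (Or.inr (Or.inr ⟨x, y, rfl, hx', hy'⟩))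

theorem fw_eq_getElem? {n m : ℕ} (h : n < m) : (Fw m)[n]? = some (fw n) := by
  have hn : n < (Fw (n + 1)).length := by
    rw [length_Fw]
    have := Nat.le_fib_add_one (n + 1 + 2)
    omega
  have h₁ : (Fw (n + 1))[n]? = some (fw n) := by
    rw [fw, List.getD_eq_getElem?_getD, List.getElem?_eq_getElem hn]
    rfl
  obtain ⟨t, ht⟩ := Fw_prefix (show n + 1 ≤ m from h)
  rw [← ht, List.getElem?_append_left hn, h₁]

theorem seg_infix_Fw (i n : ℕ) : seg i n <:+: Fw (i + n) := by
  have : seg i n = ((Fw (i + n)).drop i).take n := by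
    apply List.ext_getElem?
    intro t
    by_cases ht : t < n
    · rw [List.getElem?_take_of_lt ht, List.getElem?_drop, fw_eq_getElem? (by omega)]
      simp [seg, ht]
    · rw [List.getElem?_eq_none (by simp [seg]; omega),
        List.getElem?_eq_none (by simp; omega)]
  rw [this]
  exact (List.take_prefix _ _).isInfix.trans (List.drop_suffix _ _).isInfix

theorem classify_factor {j : ℕ} {w : List Bool} (hfac : IsFactor w)
    (hlen : w.length = (Fw (j + 1)).length) :
    w = sw (j + 2) ∨ ∃ i < (Fw (j + 1)).length, w = conj i (Fw (j + 1)) := by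
  obtain ⟨p, hp⟩ := hfac
  have h := seg_infix_Fw p w.length
  rw [OccursAt] at hp
  rw [hp] at h
  exact classify_infix_Fw hlen _ h

theorem exists_drop_Fw {k i : ℕ} (hi : i < (Fw k).length) :
    ∃ x, (Fw k).drop i = x ++ [lastLetter k] := by
  refine ⟨((Fw k).dropLast).drop i, ?_⟩
  conv_lhs => rw [← dropLast_Fw_append k]
  rw [List.drop_append_of_le_length (by rw [List.length_dropLast]; omega)]

theorem sw_succ_infix_conj {j i : ℕ} (h₁ : (Fw j).length ≤ i + 1)
    (h₂ : i < (Fw (j + 1)).length) : sw (j + 1) <:+: conj i (Fw (j + 1)) := by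
  obtain ⟨x, hx⟩ := exists_drop_Fw h₂
  have hpre : (Fw j).dropLast <+: (Fw (j + 1)).take i := by
    refine List.prefix_of_prefix_length_le
      ((List.dropLast_prefix _).trans (Fw_prefix_succ j)) (List.take_prefix _ _) ?_
    rw [List.length_dropLast, List.length_take]
    omega
  obtain ⟨y, hy⟩ := hpre
  rw [conj, Nat.mod_eq_of_lt h₂, hx, ← hy, sw_succ]
  exact ⟨x, y, by simp⟩

theorem sw_infix_conj {j i : ℕ} (hi : i < (Fw (j + 1)).length) :
    sw (j + 1) <:+: conj i (Fw (j + 2)) := by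
  obtain ⟨x, hx⟩ := exists_drop_Fw hi
  have h₂ : i < (Fw (j + 2)).length := hi.trans_le (Fw_prefix_succ (j + 1)).length_le
  rw [conj, Nat.mod_eq_of_lt h₂, sw_succ]
  refine List.IsInfix.trans ?_ (List.prefix_append _ _).isInfix
  rw [Fw, List.drop_append_of_le_length hi.le, hx]
  nth_rewrite 2 [← dropLast_Fw_append j]
  exact ⟨x, [lastLetter j], by simp⟩

theorem sw_succ_not_infix_conj {j i : ℕ} (hi : i + 2 ≤ (Fw j).length) :
    ¬ sw (j + 1) <:+: conj i (Fw (j + 1)) := by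
  intro h
  obtain ⟨P, h₁, h₂⟩ := exists_near_commute j
  have hl := congrArg List.length h₂
  have hle := (Fw_prefix_succ j).length_le
  simp only [List.length_append, List.length_cons, List.length_nil] at hl
  have hP : P <+: Fw (j + 1) ++ Fw (j + 1) :=
    List.IsPrefix.trans ⟨_, h₁.symm⟩ ((List.prefix_append_right_inj _).2 (Fw_prefix_succ j))
  have hconj : (Fw (j + 1)).take i ++ conj i (Fw (j + 1)) <+: P := by
    refine List.prefix_of_prefix_length_le ?_ hP ?_
    · rw [conj, Nat.mod_eq_of_lt (by omega), ← List.append_assoc, List.take_append_drop]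
      exact (List.prefix_append_right_inj _).2 (List.take_prefix _ _)
    · rw [List.length_append, List.length_take, conj_eq_rotate, List.length_rotate]
      omega
  obtain ⟨j, rfl⟩ : ∃ l, j = l + 1 := by
    cases j with
    | zero => simp [Fw] at hi
    | succ l => exact ⟨l, rfl⟩
  have hcube : P <+: Fw (j + 1) ++ (Fw (j + 1) ++ Fw (j + 1)) :=
    List.IsPrefix.trans ⟨_, h₂.symm⟩ ((List.prefix_append_right_inj _).2
      ((List.prefix_append_right_inj _).2 (Fw_prefix_succ j)))
  obtain ⟨i', -, h'⟩ := exists_conj_of_infix_cube (Fw_ne_nil _)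
    (by rw [length_sw, length_Fw])
    (h.trans ((List.suffix_append _ _).isInfix.trans (hconj.trans hcube).isInfix))
  exact sw_succ_ne_conj _ _ h'

theorem le_of_sw_infix_conj {j n i : ℕ} (h : sw n <:+: conj i (Fw (j + 1))) : n ≤ j + 1 := by
  by_contra! hn
  have hl := h.length_le
  rw [conj_eq_rotate, List.length_rotate, length_Fw, length_sw] at hl
  have hn' : n = j + 2 := by
    by_contra hne
    have : Nat.fib (j + 1 + 2) < Nat.fib (n + 1) :=
      (Nat.fib_lt_fib (by omega)).2 (by omega)
    omega
  subst hn'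
  exact sw_succ_ne_conj _ _
    (h.eq_of_length (by rw [length_sw, conj_eq_rotate, List.length_rotate, length_Fw]))

theorem isKernelOf_conj {j m i : ℕ} (hm : sw m <:+: conj i (Fw (j + 1)))
    (hmax : ∀ n, sw n <:+: conj i (Fw (j + 1)) → n ≤ m) :
    IsKernelOf (sw m) (conj i (Fw (j + 1))) := by
  refine ⟨⟨m, rfl⟩, hm, ?_⟩
  rintro _ ⟨n, rfl⟩ h
  rw [length_sw, length_sw]
  exact Nat.fib_mono (by have := hmax n h; omega)

theorem not_isKernelOf_of_infix {m n : ℕ} {w : List Bool} (h₁ : m < n) (h₂ : 2 ≤ n)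
    (h : sw n <:+: w) : ¬ IsKernelOf (sw m) w := by
  rintro ⟨-, -, hmax⟩
  have hl := hmax _ ⟨n, rfl⟩ h
  rw [length_sw, length_sw] at hl
  have : Nat.fib (m + 1) < Nat.fib (n + 1) := by
    calc Nat.fib (m + 1) ≤ Nat.fib n := Nat.fib_mono h₁
      _ < Nat.fib (n + 1) := Nat.fib_lt_fib_succ h₂
  omega

/-- for a factor `ω ∉ {ε,ab,ba,aba}` of `F_∞` with `|ω| = f_k` (`k ≥ 1`):
(1) `sk(ω) = s_{k-1}` iff `ω = C_i(F_k)` for some `f_{k-1}-1 ≤ i ≤ f_k-1`;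
(2) `sk(ω) = s_{k-2}` iff `ω = C_i(F_k)` for some `0 ≤ i ≤ f_{k-1}-2`. -/
theorem stmt11 (k : ℕ) (hk : 1 ≤ k) (ω : List Bool) (hfac : IsFactor ω)
    (hne : ω ∉ excl) (hlen : ω.length = Nat.fib (k+2)) :
    (IsKernelOf (sw k) ω ↔
      ∃ i : ℕ, Nat.fib (k+1) ≤ i + 1 ∧ i + 1 ≤ Nat.fib (k+2) ∧ ω = conj i (Fw k)) ∧
    (IsKernelOf (sw (k-1)) ω ↔
      ∃ i : ℕ, i + 2 ≤ Nat.fib (k+1) ∧ ω = conj i (Fw k)) := by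
  obtain ⟨j, rfl⟩ : ∃ j, k = j + 1 := ⟨k - 1, by omega⟩
  rw [Nat.add_sub_cancel]
  have hlen' : ω.length = (Fw (j + 1)).length := by rw [hlen, length_Fw]
  rw [← length_Fw j, ← length_Fw (j + 1)]
  have hle := (Fw_prefix_succ j).length_le
  rcases classify_factor hfac hlen' with rfl | ⟨i, hi, rfl⟩
  · refine ⟨iff_of_false (not_isKernelOf_of_infix (by omega) (by omega) (List.infix_refl _)) ?_,
      iff_of_false (not_isKernelOf_of_infix (by omega) (by omega) (List.infix_refl _)) ?_⟩
    · rintro ⟨i, -, -, h⟩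
      exact sw_succ_ne_conj _ _ h
    · rintro ⟨i, -, h⟩
      exact sw_succ_ne_conj _ _ h
  obtain ⟨j, rfl⟩ : ∃ l, j = l + 1 := by
    cases j with
    | zero =>
      have hi' : i < 2 := hi
      interval_cases i <;> exact absurd (by decide) hne
    | succ l => exact ⟨l, rfl⟩
  have large : ∀ {i : ℕ}, (Fw (j + 1)).length ≤ i + 1 → i < (Fw (j + 2)).length →
      IsKernelOf (sw (j + 2)) (conj i (Fw (j + 2))) := fun h₁ h₂ =>
    isKernelOf_conj (sw_succ_infix_conj h₁ h₂) fun _ => le_of_sw_infix_conj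
  have small : ∀ {i : ℕ}, i + 2 ≤ (Fw (j + 1)).length →
      IsKernelOf (sw (j + 1)) (conj i (Fw (j + 2))) := fun h =>
    isKernelOf_conj (sw_infix_conj (by omega)) fun n hn => by
      have h₁ := le_of_sw_infix_conj hn
      have h₂ : n ≠ j + 2 := by
        rintro rfl
        exact sw_succ_not_infix_conj h hn
      omega
  refine ⟨⟨fun h => ?_, ?_⟩, ⟨fun h => ?_, ?_⟩⟩
  · refine ⟨i, ?_, hi, rfl⟩
    by_contra! hlt
    exact sw_succ_not_infix_conj hlt h.2.1
  · rintro ⟨i', h₁, h₂, h⟩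
    rw [h]
    exact large h₁ h₂
  · refine ⟨i, ?_, rfl⟩
    by_contra! hlt
    exact not_isKernelOf_of_infix (by omega) (by omega)
      (sw_succ_infix_conj (by omega) hi) h
  · rintro ⟨i', h₁, h⟩
    rw [h]
    exact small h₁
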